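/- (Transversality, second Melnikov with difference.) There exist m₀ ∈ ℕ and ρ₀ > 0 such that for every κ ∈ [κ₁, κ₂], every ℓ ∈ ℤ^ν and every j, j' ∈ S₀ᶜ with (ℓ, j, j') ≠ (0, j, j) satisfying the momentum condition j⃗·ℓ + j − j' = 0: max over 0 ≤ n ≤ m₀ of |∂_κ^n ( Ω⃗(κ)·ℓ + Ω_j(κ) − Ω_{j'}(κ) )| ≥ ρ₀·⟨ℓ⟩. -/

import Mathlib

open Real Finset Set

/-- `G_j := j · tanh(dpt · j)` (finite depth `dpt`). -/
noncomputable def Gfun (dpt : ℝ) (j : ℤ) : ℝ := (j : ℝ) * Real.tanh (dpt * (j : ℝ))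

/-- The linear frequencies `ω_j(κ)`. -/
noncomputable def omegaF (dpt g γ : ℝ) (j : ℤ) (κ : ℝ) : ℝ :=
  Real.sqrt (κ * Gfun dpt j * (j : ℝ) ^ 2 + g * Gfun dpt j + (γ * Gfun dpt j / (2 * (j : ℝ))) ^ 2)

/-- The linear frequencies `Ω_j(κ) = ω_j(κ) + (γ/2) G_j / j`. -/
noncomputable def OmegaF (dpt g γ : ℝ) (j : ℤ) (κ : ℝ) : ℝ :=
  omegaF dpt g γ j κ + γ / 2 * Gfun dpt j / (j : ℝ)

theorem strictAntiOn_tanh_div_self : StrictAntiOn (fun x : ℝ => tanh x / x) (Set.Ioi 0) := by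
  have hd : ∀ x : ℝ, 0 < x →
      HasDerivAt (fun x : ℝ => tanh x / x) ((1 / cosh x ^ 2 * x - tanh x * 1) / x ^ 2) x := by
    intro x hx
    refine HasDerivAt.div ?_ (hasDerivAt_id x) hx.ne'
    have h := (hasDerivAt_sinh x).div (hasDerivAt_cosh x) (cosh_pos x).ne'
    have e : (fun y => sinh y / cosh y) = tanh := by
      ext y; rw [tanh_eq_sinh_div_cosh]
    have h' : HasDerivAt (fun y => sinh y / cosh y) _ x := h
    rw [e] at h'
    have e2 : cosh x * cosh x - sinh x * sinh x = 1 := by nlinarith [cosh_sq x]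
    rwa [e2] at h'
  refine strictAntiOn_of_deriv_neg (convex_Ioi 0)
    (fun x hx => (hd x hx).continuousAt.continuousWithinAt) fun x hx => ?_
  rw [interior_Ioi] at hx
  have hx0 : 0 < x := hx
  rw [(hd x hx).deriv]
  refine div_neg_of_neg_of_pos ?_ (by positivity)
  have hc := cosh_pos x
  have h2 : 2 * x < sinh (2 * x) := self_lt_sinh_iff.2 (by linarith)
  rw [sinh_two_mul] at h2
  have : 1 / cosh x ^ 2 * x - tanh x * 1 = (x - sinh x * cosh x) / cosh x ^ 2 := by
    rw [tanh_eq_sinh_div_cosh]; field_simp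
  rw [this]
  exact div_neg_of_neg_of_pos (by linarith) (by positivity)

theorem tanh_pos_of_pos {x : ℝ} (hx : 0 < x) : 0 < tanh x := by
  rw [tanh_eq_sinh_div_cosh]
  exact div_pos (sinh_pos_iff.2 hx) (cosh_pos x)

theorem tanh_mono : Monotone tanh := by
  intro x y hxy
  rw [tanh_eq_sinh_div_cosh, tanh_eq_sinh_div_cosh,
    div_le_div_iff₀ (cosh_pos x) (cosh_pos y)]
  have := sinh_nonneg_iff.2 (sub_nonneg.2 hxy)
  rw [sinh_sub] at this
  linarith

/-- The shift `x_s` in the factorization `ω_j(κ) = √(G_j j²) √(κ + x_{|j|})`. -/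
noncomputable def branchShift (dpt g γ s : ℝ) : ℝ :=
  g / s ^ 2 + γ ^ 2 / 4 * (tanh (dpt * s) / s / s ^ 2)

/-- The amplitude in the factorization `ω_j(κ) = √(G_j j²) √(κ + x_{|j|})`. -/
noncomputable def branchAmplitude (dpt s : ℝ) : ℝ := √(s ^ 3 * tanh (dpt * s))

theorem branchShift_pos {dpt g γ s : ℝ} (hdpt : 0 < dpt) (hg : 0 < g) (hs : 0 < s) :
    0 < branchShift dpt g γ s := by
  have := tanh_pos_of_pos (mul_pos hdpt hs)
  unfold branchShift
  positivity

theorem strictAntiOn_branchShift {dpt g γ : ℝ} (hdpt : 0 < dpt) (hg : 0 < g) :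
    StrictAntiOn (branchShift dpt g γ) (Set.Ioi 0) := by
  intro s hs t ht hst
  have hs0 : 0 < s := hs
  have ht0 : 0 < t := ht
  have h1 : tanh (dpt * t) / (dpt * t) ≤ tanh (dpt * s) / (dpt * s) :=
    (strictAntiOn_tanh_div_self (mul_pos hdpt hs0) (mul_pos hdpt ht0)
      (mul_lt_mul_of_pos_left hst hdpt)).le
  have h2 : tanh (dpt * t) / t ≤ tanh (dpt * s) / s := by
    have e : ∀ u : ℝ, tanh (dpt * u) / u = dpt * (tanh (dpt * u) / (dpt * u)) := by
      intro u; field_simp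
    rw [e t, e s]
    exact mul_le_mul_of_nonneg_left h1 hdpt.le
  have h3 := tanh_pos_of_pos (mul_pos hdpt hs0)
  have h4 : s ^ 2 < t ^ 2 := by gcongr
  unfold branchShift
  refine add_lt_add_of_lt_of_le (div_lt_div_of_pos_left hg (by positivity) h4) ?_
  gcongr

theorem branchAmplitude_one_le {dpt s : ℝ} (hdpt : 0 < dpt) (hs : 1 ≤ s) :
    branchAmplitude dpt 1 ≤ branchAmplitude dpt s := by
  unfold branchAmplitude
  have h1 : tanh (dpt * 1) ≤ tanh (dpt * s) := 
    tanh_mono (by simpa using mul_le_mul_of_nonneg_left hs hdpt.le)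
  have h0 := tanh_pos_of_pos (mul_pos hdpt one_pos)
  gcongr

theorem omegaF_eq {dpt g γ κ : ℝ} {j : ℤ} (hdpt : 0 < dpt) (hj : j ≠ 0) :
    omegaF dpt g γ j κ =
      branchAmplitude dpt ((|j| : ℤ) : ℝ) * √(κ + branchShift dpt g γ ((|j| : ℤ) : ℝ)) := by
  have hj' : (j : ℝ) ≠ 0 := by exact_mod_cast hj
  have hs : (0 : ℝ) < |(j : ℝ)| := abs_pos.2 hj'
  have hG : Gfun dpt j = |(j : ℝ)| * tanh (dpt * |(j : ℝ)|) := by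
    unfold Gfun
    rcases abs_choice (j : ℝ) with h | h <;> rw [h]
    rw [mul_neg, tanh_neg]; ring
  have ht := tanh_pos_of_pos (mul_pos hdpt hs)
  have hsq : (j : ℝ) ^ 2 = |(j : ℝ)| ^ 2 := (sq_abs _).symm
  unfold omegaF branchAmplitude branchShift
  rw [hG, div_pow, mul_pow, mul_pow 2, hsq, Int.cast_abs, ← Real.sqrt_mul (by positivity)]
  congr 1
  generalize tanh (dpt * |(j : ℝ)|) = T
  field_simp
  ring

/-- The coefficients `∏_{k < n} (1/2 - k)` of the iterated derivatives of the square root. -/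
noncomputable def sqrtDerivCoeff (n : ℕ) : ℝ := ∏ k ∈ Finset.range n, ((1 : ℝ) / 2 - k)

theorem le_abs_sqrtDerivCoeff (n : ℕ) : (1 / 2 : ℝ) ^ n ≤ |sqrtDerivCoeff n| := by
  unfold sqrtDerivCoeff
  rw [Finset.abs_prod]
  have : (1 / 2 : ℝ) ^ n = ∏ k ∈ Finset.range n, (1 / 2 : ℝ) := by simp
  rw [this]
  refine Finset.prod_le_prod (fun _ _ => by norm_num) fun k _ => ?_
  rcases Nat.eq_zero_or_pos k with rfl | hk
  · norm_num
  · have : (1 : ℝ) ≤ k := by exact_mod_cast hk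
    rw [le_abs]; right; linarith

theorem hasDerivAt_sqrt_mul_inv_pow {κ x : ℝ} (h : 0 < κ + x) (n : ℕ) :
    HasDerivAt (fun t => √(t + x) * (t + x)⁻¹ ^ n)
      ((1 / 2 - n) * (√(κ + x) * (κ + x)⁻¹ ^ (n + 1))) κ := by
  have h0 : HasDerivAt (fun t => t + x) 1 κ := (hasDerivAt_id κ).add_const x
  have h1 := (h0.sqrt h.ne').mul ((h0.inv h.ne').pow n)
  refine h1.congr_deriv ?_
  simp only [Pi.inv_apply, Pi.pow_apply]
  have hs : 0 < √(κ + x) := sqrt_pos.2 h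
  obtain ⟨u, hu0, hu⟩ : ∃ u, 0 < u ∧ κ + x = u ^ 2 := ⟨_, hs, (sq_sqrt h.le).symm⟩
  rw [hu, sqrt_sq hu0.le]
  rcases n with _ | n
  · simp; field_simp
  · simp only [Nat.add_sub_cancel]
    push_cast
    simp only [pow_succ (u ^ 2)⁻¹]
    generalize (u ^ 2)⁻¹ ^ n = z
    field_simp
    ring

theorem iteratedDeriv_sum_sqrt {ι : Type*} [Fintype ι] (c : ℝ) (b x : ι → ℝ)
    (hx : ∀ i, 0 < x i) (n : ℕ) {κ : ℝ} (hκ : 0 < κ) :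
    iteratedDeriv (n + 1) (fun t => c + ∑ i, b i * √(t + x i)) κ =
      sqrtDerivCoeff (n + 1) * ∑ i, b i * (√(κ + x i) * (κ + x i)⁻¹ ^ (n + 1)) := by
  have step : ∀ (m : ℕ) {κ : ℝ}, 0 < κ →
      HasDerivAt (fun t => sqrtDerivCoeff m * ∑ i, b i * (√(t + x i) * (t + x i)⁻¹ ^ m))
        (sqrtDerivCoeff (m + 1) * ∑ i, b i * (√(κ + x i) * (κ + x i)⁻¹ ^ (m + 1))) κ := by
    intro m κ hκ
    have h := (HasDerivAt.fun_sum (u := Finset.univ) fun i _ =>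
      (hasDerivAt_sqrt_mul_inv_pow (add_pos hκ (hx i)) m).const_mul (b i)).const_mul
        (sqrtDerivCoeff m)
    refine h.congr_deriv ?_
    have e : sqrtDerivCoeff (m + 1) = sqrtDerivCoeff m * (1 / 2 - m) := Finset.prod_range_succ _ _
    rw [e, mul_assoc, Finset.mul_sum, Finset.mul_sum, Finset.mul_sum]
    exact Finset.sum_congr rfl fun i _ => by ring
  induction n generalizing κ with
  | zero =>
    rw [zero_add, iteratedDeriv_one]
    have h := (step 0 hκ).const_add c
    simp only [pow_zero, mul_one, sqrtDerivCoeff, Finset.range_zero, Finset.prod_empty, one_mul]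
      at h
    exact h.deriv
  | succ n ih =>
    rw [iteratedDeriv_succ]
    have he : iteratedDeriv (n + 1) (fun t => c + ∑ i, b i * √(t + x i)) =ᶠ[nhds κ]
        fun t => sqrtDerivCoeff (n + 1) * ∑ i, b i * (√(t + x i) * (t + x i)⁻¹ ^ (n + 1)) := by
      filter_upwards [lt_mem_nhds hκ] with t ht using ih ht
    rw [he.deriv_eq]
    exact (step (n + 1) hκ).deriv

theorem abs_sum_mul_prod_sub_le {ι : Type*} [Fintype ι] {v y : ι → ℝ} {M ε : ℝ} {N : ℕ}
    (hM : 0 ≤ M) (h : ∀ n, 1 ≤ n → n ≤ N → |∑ i, v i * y i ^ n| ≤ ε)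
    (s : Finset ℝ) (hs : ∀ r ∈ s, |r| ≤ M) (p : ℕ) (hp : 1 ≤ p) (hpN : p + #s ≤ N) :
    |∑ i, v i * (y i ^ p * ∏ r ∈ s, (y i - r))| ≤ (1 + M) ^ #s * ε := by
  induction s using Finset.induction_on generalizing p with
  | empty => simpa using h p hp (by simpa using hpN)
  | insert r s hr ih =>
    rw [Finset.card_insert_of_notMem hr] at hpN ⊢
    have hs' : ∀ r ∈ s, |r| ≤ M := fun q hq => hs q (Finset.mem_insert_of_mem hq)
    have h1 := ih hs' (p + 1) (by omega) (by omega)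
    have h2 := ih hs' p hp (by omega)
    have hrM := hs r (Finset.mem_insert_self _ _)
    have e : ∑ i, v i * (y i ^ p * ∏ q ∈ insert r s, (y i - q)) =
        ∑ i, v i * (y i ^ (p + 1) * ∏ q ∈ s, (y i - q)) -
          r * ∑ i, v i * (y i ^ p * ∏ q ∈ s, (y i - q)) := by
      rw [Finset.mul_sum, ← Finset.sum_sub_distrib]
      refine Finset.sum_congr rfl fun i _ => ?_
      rw [Finset.prod_insert hr]; ring
    rw [e]
    calc _ ≤ _ := abs_sub _ _
      _ ≤ (1 + M) ^ #s * ε + M * ((1 + M) ^ #s * ε) := by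
        rw [abs_mul]; gcongr
      _ = _ := by ring

/-- Quantitative Vandermonde estimate: small power sums force the total weight at an isolated
node `t` to be small. -/
theorem abs_sum_filter_le_of_power_sums {ι : Type*} [Fintype ι] {v y : ι → ℝ} {M ε δ μ t : ℝ}
    (hδ : 0 < δ) (hδ1 : δ ≤ 1) (ht : μ ≤ t) (hy : ∀ i, |y i| ≤ M) (hM : 0 ≤ M)
    (hε : 0 ≤ ε) (hsep : ∀ i, y i ≠ t → δ ≤ |t - y i|)
    (h : ∀ n, 1 ≤ n → n ≤ Fintype.card ι + 1 → |∑ i, v i * y i ^ n| ≤ ε) :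
    |∑ i with y i = t, v i| * (μ * δ ^ Fintype.card ι) ≤ (1 + M) ^ Fintype.card ι * ε := by
  classical
  set s : Finset ℝ := (Finset.univ.image y).erase t with hs
  have hcard : #s ≤ Fintype.card ι :=
    (Finset.card_erase_le).trans (Finset.card_image_le.trans_eq Finset.card_univ)
  have hmem : ∀ r ∈ s, r ≠ t ∧ ∃ i, y i = r := by
    intro r hr
    simpa [hs] using hr
  have key := abs_sum_mul_prod_sub_le hM h s
    (fun r hr => by obtain ⟨-, i, rfl⟩ := hmem r hr; exact hy i) 1 le_rfl (by omega)
  have e : ∑ i, v i * (y i ^ 1 * ∏ r ∈ s, (y i - r)) =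
      (∑ i with y i = t, v i) * (t * ∏ r ∈ s, (t - r)) := by
    rw [Finset.sum_mul, Finset.sum_filter]
    refine Finset.sum_congr rfl fun i _ => ?_
    split_ifs with hi
    · rw [hi, pow_one]
    · have : y i ∈ s := by simp [hs, hi]
      rw [Finset.prod_eq_zero this (sub_self _)]; simp
  rw [e, abs_mul, abs_mul, Finset.abs_prod] at key
  have hprod : δ ^ Fintype.card ι ≤ ∏ r ∈ s, |t - r| :=
    calc _ ≤ δ ^ #s := pow_le_pow_of_le_one hδ.le hδ1 hcard
      _ = ∏ r ∈ s, δ := by simp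
      _ ≤ _ := Finset.prod_le_prod (fun _ _ => hδ.le) fun r hr => by
        obtain ⟨hrt, i, rfl⟩ := hmem r hr
        exact hsep i hrt
  calc _ ≤ |∑ i with y i = t, v i| * (|t| * ∏ r ∈ s, |t - r|) := by
        gcongr
        exact ht.trans (le_abs_self t)
    _ ≤ (1 + M) ^ #s * ε := key
    _ ≤ _ := by gcongr; linarith

/-- The values of a strictly antitone function at the positive integers stay away from its value
at a given positive integer. -/
theorem exists_isolation_of_strictAntiOn {X : ℝ → ℝ} (hX : StrictAntiOn X (Set.Ioi 0)) {t : ℤ}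
    (ht : 0 < t) : ∃ δ > 0, ∀ k : ℤ, 0 < k → k ≠ t → δ ≤ |X k - X t| := by
  have ht' : (0 : ℝ) < t := by exact_mod_cast ht
  have h1 : X ((t : ℝ) + 1) < X t :=
    hX ht' (show (0 : ℝ) < t + 1 by linarith) (by linarith)
  have hgt : ∀ k : ℤ, t < k → X k ≤ X ((t : ℝ) + 1) := fun k hk => by
    have : (t : ℝ) + 1 ≤ k := by exact_mod_cast hk
    exact hX.antitoneOn (show (0 : ℝ) < t + 1 by linarith) (show (0 : ℝ) < k by linarith) this
  rcases eq_or_lt_of_le (show 1 ≤ t from ht) with h | h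
  · refine ⟨X t - X ((t : ℝ) + 1), by linarith, fun k hk hkt => ?_⟩
    have := hgt k (by omega)
    rw [le_abs]; right; linarith
  · have h' : (1 : ℝ) < t := by exact_mod_cast h
    have h2 : X t < X ((t : ℝ) - 1) :=
      hX (show (0 : ℝ) < t - 1 by linarith) ht' (by linarith)
    refine ⟨min (X t - X ((t : ℝ) + 1)) (X ((t : ℝ) - 1) - X t),
      lt_min (by linarith) (by linarith), fun k hk hkt => ?_⟩
    rcases lt_or_gt_of_ne hkt with hlt | hlt
    · have hk' : (0 : ℝ) < k := by exact_mod_cast hk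
      have hk2 : (k : ℝ) ≤ t - 1 := by
        have : k ≤ t - 1 := by omega
        exact_mod_cast this
      have := hX.antitoneOn hk' (show (0 : ℝ) < t - 1 by linarith) hk2
      exact (min_le_right _ _).trans (le_abs.2 (Or.inl (by linarith)))
    · have := hgt k hlt
      exact (min_le_left _ _).trans (le_abs.2 (Or.inr (by linarith)))

/-- All sites occurring in `Ω⃗·ℓ + Ω_j - Ω_{j'}`. -/
def melnikovSite {ν : ℕ} (jbar : Fin ν → ℤ) (j j' : ℤ) : Option (Option (Fin ν)) → ℤ
  | none => j
  | some none => j'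
  | some (some a) => jbar a

/-- The coefficients in `Ω⃗·ℓ + Ω_j - Ω_{j'}`. -/
def melnikovCoeff {ν : ℕ} (ℓ : Fin ν → ℤ) : Option (Option (Fin ν)) → ℤ
  | none => 1
  | some none => -1
  | some (some a) => ℓ a

theorem exists_isolated_large_coeff {ν : ℕ} {jbar : Fin ν → ℤ}
    (hjinj : Function.Injective fun a => |jbar a|) {ℓ : Fin ν → ℤ} {j j' : ℤ}
    (hjS : ∀ a, j ≠ jbar a) (hjS' : ∀ a, j' ≠ jbar a) (hℓ : ℓ ≠ 0)
    (hmom : (∑ a, jbar a * ℓ a) + j - j' = 0) :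
    ∃ i₀, (∀ i, |melnikovSite jbar j j' i| ≠ |melnikovSite jbar j j' i₀| →
        ∃ a, |melnikovSite jbar j j' i| = |jbar a| ∨ |melnikovSite jbar j j' i₀| = |jbar a|) ∧
      ∀ a, |ℓ a| ≤ 2 * |∑ i with |melnikovSite jbar j j' i| = |melnikovSite jbar j j' i₀|,
        melnikovCoeff ℓ i| := by
  have hsum : ∀ t : ℤ, ∑ i with |melnikovSite jbar j j' i| = |t|, melnikovCoeff ℓ i =
      (if |j| = |t| then 1 else 0) + ((if |j'| = |t| then -1 else 0) +
        ∑ a, if |jbar a| = |t| then ℓ a else 0) := by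
    intro t
    rw [Finset.sum_filter, Fintype.sum_option, Fintype.sum_option]
    rfl
  have hsumS : ∀ b, ∑ i with |melnikovSite jbar j j' i| = |jbar b|, melnikovCoeff ℓ i =
      (if j = -jbar b then 1 else 0) + ((if j' = -jbar b then -1 else 0) + ℓ b) := by
    intro b
    have e : ∀ k : ℤ, (∀ a, k ≠ jbar a) → (|k| = |jbar b| ↔ k = -jbar b) := fun k hk => by
      rw [abs_eq_abs]; simp [hk b]
    have e2 : ∀ a, |jbar a| = |jbar b| ↔ a = b := fun a => hjinj.eq_iff
    rw [hsum]
    simp only [e j hjS, e j' hjS', e2]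
    simp
  obtain ⟨a₁, -⟩ : ∃ a, ℓ a ≠ 0 := Function.ne_iff.1 hℓ
  have : Nonempty (Fin ν) := ⟨a₁⟩
  obtain ⟨a, ha⟩ := Finite.exists_max fun a => |ℓ a|
  have ha0 : ℓ a ≠ 0 := by
    intro h
    refine hℓ (funext fun b => ?_)
    have := ha b
    simp only [h, abs_zero] at this
    simpa using this
  by_cases hN : ∃ b, |ℓ a| ≤ 2 * |(if j = -jbar b then (1 : ℤ) else 0) +
      ((if j' = -jbar b then -1 else 0) + ℓ b)|
  · obtain ⟨b, hb⟩ := hN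
    refine ⟨some (some b), fun i _ => ⟨b, Or.inr rfl⟩, fun c => (ha c).trans ?_⟩
    have e : melnikovSite jbar j j' (some (some b)) = jbar b := rfl
    rw [e, hsumS]
    exact hb
  push Not at hN
  have hla : |ℓ a| = 1 := by
    have h1 := hN a
    have h2 : 1 ≤ |ℓ a| := Int.one_le_abs ha0
    split_ifs at h1 <;> grind
  have hℓb : ∀ b, ℓ b = (if j' = -jbar b then 1 else 0) - (if j = -jbar b then 1 else 0) := by
    intro b
    have h1 := hN b
    rw [hla] at h1
    have h2 : (if j = -jbar b then (1 : ℤ) else 0) +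
        ((if j' = -jbar b then -1 else 0) + ℓ b) = 0 := by
      grind
    split_ifs at h2 ⊢ <;> omega
  have hnot : ∀ k : ℤ, (∀ a, k ≠ jbar a) → (∀ b, k ≠ -jbar b) → ∀ b, |jbar b| ≠ |k| := by
    intro k h1 h2 b h
    rcases abs_eq_abs.1 h with h | h
    · exact h1 b h.symm
    · exact h2 b (by omega)
  have hS : ∀ (k : ℤ) (b : Fin ν), k = -jbar b →
      ∑ c, jbar c * (if k = -jbar c then 1 else 0) = -k := by
    intro k b hb
    have e : ∀ c, (k = -jbar c) ↔ c = b := fun c => by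
      constructor
      · intro h; apply hjinj; show |jbar c| = |jbar b|; rw [neg_inj.1 (h.symm.trans hb)]
      · rintro rfl; exact hb
    simp only [e]
    simp [hb]
  have bound : ∀ m : ℤ, m ≠ 0 → ∀ c, |ℓ c| ≤ 2 * |m| := fun m hm c => by
    have := ha c
    have := Int.one_le_abs hm
    omega
  by_cases h1 : ∃ b, j = -jbar b <;> by_cases h2 : ∃ b, j' = -jbar b
  · obtain ⟨b, hb⟩ := h1
    obtain ⟨b', hb'⟩ := h2
    exfalso
    have : ∑ c, jbar c * ℓ c = -j' - -j := by
      rw [← hS j b hb, ← hS j' b' hb', ← Finset.sum_sub_distrib]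
      exact Finset.sum_congr rfl fun c _ => by rw [hℓb c, mul_sub]
    have hjj : j = j' := by omega
    exact ha0 (by rw [hℓb a, hjj, sub_self])
  · obtain ⟨b, hb⟩ := h1
    push Not at h2
    have hn := hnot j' hjS' h2
    have hjb : |j| = |jbar b| := by rw [hb, abs_neg]
    refine ⟨some none, fun i hi => ?_, bound _ ?_⟩
    · rcases i with _ | _ | c
      · exact ⟨b, Or.inl hjb⟩
      · exact absurd rfl hi
      · exact ⟨c, Or.inl rfl⟩
    · have e : melnikovSite jbar j j' (some none) = j' := rfl
      rw [e, hsum]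
      simp [hn, hjb]
  · obtain ⟨b, hb⟩ := h2
    push Not at h1
    have hn := hnot j hjS h1
    have hjb : |j'| = |jbar b| := by rw [hb, abs_neg]
    refine ⟨none, fun i hi => ?_, bound _ ?_⟩
    · rcases i with _ | _ | c
      · exact absurd rfl hi
      · exact ⟨b, Or.inl hjb⟩
      · exact ⟨c, Or.inl rfl⟩
    · have e : melnikovSite jbar j j' none = j := rfl
      rw [e, hsum]
      simp [hn, hjb]
  · push Not at h1 h2
    exact absurd (by rw [hℓb a]; simp [h1 a, h2 a]) ha0

/-- Transversality, second Melnikov conditions with difference (with momentum condition). -/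
theorem transversality_2nd_Melnikov_difference
    (dpt g γ κ₁ κ₂ : ℝ) (hdpt : 0 < dpt) (hg : 0 < g) (hκ₁ : 0 < κ₁) (hκ₁₂ : κ₁ < κ₂)
    (ν : ℕ) (hν : 1 ≤ ν) (jbar : Fin ν → ℤ)
    (hjne : ∀ a, jbar a ≠ 0)
    (hjinj : Function.Injective fun a => |jbar a|) :
    ∃ m₀ : ℕ, ∃ ρ₀ > (0 : ℝ), ∀ κ ∈ Set.Icc κ₁ κ₂, ∀ ℓ : Fin ν → ℤ, ∀ j j' : ℤ,
      j ≠ 0 → (∀ a, j ≠ jbar a) → j' ≠ 0 → (∀ a, j' ≠ jbar a) →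
      ¬(ℓ = 0 ∧ j = j') → (∑ a, jbar a * ℓ a) + j - j' = 0 →
      ∃ n ≤ m₀, ρ₀ * max 1 ‖ℓ‖ ≤
        |iteratedDeriv n
          (fun κ' => (∑ a, (ℓ a : ℝ) * OmegaF dpt g γ (jbar a) κ')
            + OmegaF dpt g γ j κ' - OmegaF dpt g γ j' κ') κ| := by
  set X := branchShift dpt g γ
  have hXanti : StrictAntiOn X (Set.Ioi 0) := strictAntiOn_branchShift hdpt hg
  have hXpos : ∀ s : ℝ, 0 < s → 0 < X s := fun s hs => branchShift_pos hdpt hg hs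
  have hX1 : ∀ s : ℝ, 1 ≤ s → X s ≤ X 1 := fun s hs =>
    hXanti.antitoneOn (show (0 : ℝ) < 1 by norm_num) (show (0 : ℝ) < s by linarith) hs
  obtain ⟨d, hd, hdsep⟩ : ∃ d > 0, ∀ a, ∀ k : ℤ, 0 < k → k ≠ |jbar a| →
      d ≤ |X k - X ((|jbar a| : ℤ) : ℝ)| := by
    choose δ hδ hδsep using fun a =>
      exists_isolation_of_strictAntiOn hXanti (abs_pos.2 (hjne a))
    have : Nonempty (Fin ν) := ⟨⟨0, hν⟩⟩
    obtain ⟨a₀, ha₀⟩ := Finite.exists_min δ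
    exact ⟨δ a₀, hδ a₀, fun a k hk hka => (ha₀ a).trans (hδsep a k hk hka)⟩
  have hκ₂ : 0 < κ₂ := hκ₁.trans hκ₁₂
  have hX1pos := hXpos 1 one_pos
  set K := κ₂ + X 1
  have hKpos : 0 < K := by positivity
  set δ := min 1 (d / K ^ 2)
  have hδ : 0 < δ := lt_min one_pos (by positivity)
  set ι := Option (Option (Fin ν))
  set c := Fintype.card ι
  set w := branchAmplitude dpt 1 * √κ₁ with hw
  have hwpos : 0 < w := by
    have := tanh_pos_of_pos (mul_pos hdpt one_pos)
    have : 0 < branchAmplitude dpt 1 := sqrt_pos.2 (by positivity)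
    have : 0 < √κ₁ := sqrt_pos.2 hκ₁
    positivity
  set D := (1 + κ₁⁻¹) ^ c * 2 ^ (c + 1) with hD
  have hDpos : 0 < D := by positivity
  refine ⟨c + 1, w * (K⁻¹ * δ ^ c) / (4 * D), by positivity, ?_⟩
  rintro κ ⟨hκl, hκu⟩ ℓ j j' hj hjS hj' hjS' hnt hmom
  have hκ : 0 < κ := hκ₁.trans_le hκl
  have hℓ : ℓ ≠ 0 := by
    rintro rfl
    refine hnt ⟨rfl, ?_⟩
    simp at hmom
    omega
  obtain ⟨i₀, hiso, hlarge⟩ := exists_isolated_large_coeff hjinj hjS hjS' hℓ hmom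
  set J := melnikovSite jbar j j' with hJ
  set m := melnikovCoeff ℓ with hm
  have hJne : ∀ i, J i ≠ 0 := by
    rintro (_ | _ | a)
    exacts [hj, hj', hjne a]
  set s : ι → ℝ := fun i => ((|J i| : ℤ) : ℝ) with hs
  have hs1 : ∀ i, 1 ≤ s i := fun i => by
    have := Int.one_le_abs (hJne i)
    simp only [hs]
    exact_mod_cast this
  have hs0 : ∀ i, 0 < s i := fun i => one_pos.trans_le (hs1 i)
  have hnorm : 1 ≤ ‖ℓ‖ := by
    obtain ⟨a, ha⟩ := Function.ne_iff.1 hℓ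
    refine le_trans ?_ (norm_le_pi_norm ℓ a)
    rw [Int.norm_eq_abs]
    exact_mod_cast Int.one_le_abs ha
  have hnormle : ‖ℓ‖ ≤ 2 * |((∑ i with |J i| = |J i₀|, m i : ℤ) : ℝ)| := by
    rw [pi_norm_le_iff_of_nonneg (by positivity)]
    intro a
    rw [Int.norm_eq_abs]
    exact_mod_cast hlarge a
  rw [max_eq_right hnorm]
  have hF : (fun κ' => (∑ a, (ℓ a : ℝ) * OmegaF dpt g γ (jbar a) κ')
      + OmegaF dpt g γ j κ' - OmegaF dpt g γ j' κ') =
      fun t => (∑ i, (m i : ℝ) * (γ / 2 * Gfun dpt (J i) / (J i : ℝ))) +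
        ∑ i, ((m i : ℝ) * branchAmplitude dpt (s i)) * √(t + X (s i)) := by
    ext t
    have : ∀ i, ((m i : ℝ) * branchAmplitude dpt (s i)) * √(t + X (s i)) =
        m i * omegaF dpt g γ (J i) t := fun i => by
      rw [omegaF_eq hdpt (hJne i), mul_assoc]
    simp only [this]
    rw [← Finset.sum_add_distrib]
    simp only [← mul_add]
    rw [Fintype.sum_option, Fintype.sum_option]
    simp only [hm, hJ, melnikovCoeff, melnikovSite, OmegaF, add_comm (omegaF _ _ _ _ _)]
    push_cast
    ring
  rw [hF]
  by_contra! hcon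
  set y : ι → ℝ := fun i => (κ + X (s i))⁻¹ with hy
  set v : ι → ℝ := fun i => (m i : ℝ) * branchAmplitude dpt (s i) * √(κ + X (s i)) with hv
  set ρ := w * (K⁻¹ * δ ^ c) / (4 * D) with hρ
  have hden : ∀ i, 0 < κ + X (s i) := fun i => add_pos hκ (hXpos _ (hs0 i))
  have hdenK : ∀ i, κ + X (s i) ≤ K := fun i => add_le_add hκu (hX1 _ (hs1 i))
  have hpow : ∀ n, 1 ≤ n → n ≤ c + 1 → |∑ i, v i * y i ^ n| ≤ 2 ^ (c + 1) * (ρ * ‖ℓ‖) := by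
    intro n hn hnc
    obtain ⟨n, rfl⟩ : ∃ k, n = k + 1 := ⟨n - 1, by omega⟩
    have h1 := hcon (n + 1) hnc
    rw [iteratedDeriv_sum_sqrt _ _ _ (fun i => hXpos _ (hs0 i)) n hκ, abs_mul] at h1
    simp only [← mul_assoc] at h1
    have h2 : (1 / 2 : ℝ) ^ (c + 1) ≤ |sqrtDerivCoeff (n + 1)| :=
      (pow_le_pow_of_le_one (by norm_num) (by norm_num) hnc).trans (le_abs_sqrtDerivCoeff _)
    have h3 := (mul_le_mul_of_nonneg_right h2 (abs_nonneg (∑ i, v i * y i ^ (n + 1)))).trans h1.le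
    rw [one_div, inv_pow, inv_mul_le_iff₀ (by positivity)] at h3
    exact h3
  have hXne : ∀ i, |J i| ≠ |J i₀| → d ≤ |X (s i) - X (s i₀)| := by
    intro i hi
    obtain ⟨a, h | h⟩ := hiso i hi
    · have := hdsep a |J i₀| (abs_pos.2 (hJne i₀)) (h ▸ hi.symm)
      rw [← h, abs_sub_comm] at this
      exact this
    · have := hdsep a |J i| (abs_pos.2 (hJne i)) (h ▸ hi)
      rw [← h] at this
      exact this
  have hyeq : ∀ i, y i = y i₀ ↔ |J i| = |J i₀| := by
    intro i
    constructor
    · intro h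
      by_contra hne
      have h1 := hXne i hne
      have h2 : κ + X (s i) = κ + X (s i₀) := inv_injective h
      rw [add_left_cancel h2, sub_self, abs_zero] at h1
      linarith
    · intro h
      simp only [hy, hs, h]
  have hsep : ∀ i, y i ≠ y i₀ → δ ≤ |y i₀ - y i| := by
    intro i hi
    have h1 := hXne i (fun h => hi ((hyeq i).2 h))
    have e : y i₀ - y i = (X (s i) - X (s i₀)) / ((κ + X (s i₀)) * (κ + X (s i))) := by
      have := (hden i).ne'
      have := (hden i₀).ne'
      simp only [hy]
      field_simp
      ring
    rw [e, abs_div, abs_of_pos (mul_pos (hden i₀) (hden i))]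
    refine (min_le_right _ _).trans ?_
    have h3 : (κ + X (s i₀)) * (κ + X (s i)) ≤ K ^ 2 := by
      rw [sq]
      exact mul_le_mul (hdenK i₀) (hdenK i) (hden i).le hKpos.le
    have := mul_pos (hden i₀) (hden i)
    gcongr
  have hyM : ∀ i, |y i| ≤ κ₁⁻¹ := fun i => by
    rw [abs_of_pos (inv_pos.2 (hden i))]
    exact inv_anti₀ hκ₁ (by linarith [hXpos _ (hs0 i)])
  have hρpos : 0 < ρ := by positivity
  have key := abs_sum_filter_le_of_power_sums (v := v) (y := y) (μ := K⁻¹) (t := y i₀)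
    hδ (min_le_left _ _) (inv_anti₀ (hden i₀) (hdenK i₀)) hyM
    (inv_pos.2 hκ₁).le (by positivity) hsep hpow
  have hsumv : ∑ i with y i = y i₀, v i =
      ((∑ i with |J i| = |J i₀|, m i : ℤ) : ℝ) *
        (branchAmplitude dpt (s i₀) * √(κ + X (s i₀))) := by
    simp only [hyeq]
    rw [Int.cast_sum, Finset.sum_mul]
    refine Finset.sum_congr rfl fun i hi => ?_
    have h : |J i| = |J i₀| := (Finset.mem_filter.1 hi).2
    simp only [hv, hs, h, mul_assoc]
  have hwle : w ≤ branchAmplitude dpt (s i₀) * √(κ + X (s i₀)) :=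
    mul_le_mul (branchAmplitude_one_le hdpt (hs1 i₀))
      (sqrt_le_sqrt (by linarith [hXpos _ (hs0 i₀)])) (sqrt_nonneg _) (sqrt_nonneg _)
  rw [hsumv, abs_mul, abs_of_pos (hwpos.trans_le hwle)] at key
  have hlow : ‖ℓ‖ / 2 * w * (K⁻¹ * δ ^ c) ≤ D * (ρ * ‖ℓ‖) := by
    refine le_trans ?_ (key.trans_eq (by rw [hD]; ring))
    gcongr
    linarith
  have hDρ : D * (ρ * ‖ℓ‖) = ‖ℓ‖ / 4 * w * (K⁻¹ * δ ^ c) := by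
    rw [hρ]; field_simp
  have hp : 0 < w * (K⁻¹ * δ ^ c) := by positivity
  rw [hDρ] at hlow
  nlinarith
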